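/- Let q be an odd prime power, let C ∈ GL_n(𝔽_q) normalize the diagonal torus with C² a scalar matrix, let θ(a) = C a C⁻¹ be the corresponding involution of GL_n(𝔽_q), and let τ be the permutation of {0,…,n-1} induced by C (so τ is an involution). Let T = (T₀,…,T_{m-1}) be an ordered partition of {0,…,n-1} with associated function f = f_T, and let x be a representation of the parabolic P(T) on which the unipotent radical U(T) acts trivially. Suppose v is a vector of x fixed by every p ∈ P(T) with θ(p) = p. Then for every matrix N with N_{ij} = 0 unless f(i) = f(j) and f(τ(i)) < f(τ(j)), the element I + N lies in P(T) and satisfies (I + N)v = v. -/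

import Mathlib

open Matrix

noncomputable section

namespace Paper

/-- nonzero vector invariant under a set of group elements -/
def HasInvVec {G V : Type*} [Group G] [AddCommGroup V] [Module ℂ V]
    (π : Representation ℂ G V) (S : Set G) : Prop :=
  ∃ v : V, v ≠ 0 ∧ ∀ g ∈ S, π g v = v

/-- nonzero invariant linear functional -/
def HasInvFunctional {G V : Type*} [Group G] [AddCommGroup V] [Module ℂ V]
    (π : Representation ℂ G V) (S : Set G) : Prop :=
  ∃ ℓ : Module.Dual ℂ V, ℓ ≠ 0 ∧ ∀ g ∈ S, ∀ v : V, ℓ (π g v) = ℓ v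

/-- isomorphism of representations -/
def RepIso {G V W : Type*} [Group G] [AddCommGroup V] [Module ℂ V] [AddCommGroup W] [Module ℂ W]
    (π : Representation ℂ G V) (π' : Representation ℂ G W) : Prop :=
  ∃ e : V ≃ₗ[ℂ] W, ∀ (g : G) (v : V), e (π g v) = π' g (e v)

/-- irreducibility -/
def IsIrred {G V : Type*} [Group G] [AddCommGroup V] [Module ℂ V]
    (π : Representation ℂ G V) : Prop :=
  (∃ v : V, v ≠ 0) ∧
    ∀ W : Submodule ℂ V, (∀ (g : G), ∀ v ∈ W, π g v ∈ W) → W = ⊥ ∨ W = ⊤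

/-- membership in the "unipotent radical" pattern for the partition function `f`:
the matrix agrees with the identity except at entries `(i,j)` with `f i < f j`. -/
def unipMem {F : Type*} [Field F] {n m : ℕ} (f : Fin n → Fin m)
    (A : Matrix (Fin n) (Fin n) F) : Prop :=
  ∀ i j, ¬ f i < f j → A i j = (1 : Matrix (Fin n) (Fin n) F) i j

/-- a representation of `GL_n(F)` is cuspidal if for every proper standard parabolic
(given by a monotone surjection onto `Fin m`, `m ≥ 2`), the only vector invariant under the
corresponding unipotent radical is zero. -/
def IsCuspidal {F : Type*} [Field F] {n : ℕ} {V : Type*} [AddCommGroup V] [Module ℂ V]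
    (π : Representation ℂ (GL (Fin n) F) V) : Prop :=
  ∀ (m : ℕ) (f : Fin n → Fin m), 2 ≤ m → Monotone f → Function.Surjective f →
    ∀ v : V, (∀ A : GL (Fin n) F, unipMem f (A : Matrix (Fin n) (Fin n) F) → π A v = v) → v = 0

/-- the standard parabolic subgroup attached to a partition function `f` (block
upper-triangular invertible matrices). -/
def parabolic {F : Type*} [Field F] {n m : ℕ} (f : Fin n → Fin m) : Subgroup (GL (Fin n) F) where
  carrier := {A | BlockTriangular (A : Matrix (Fin n) (Fin n) F) f}
  one_mem' := by simpa using blockTriangular_one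
  mul_mem' := fun ha hb => by simpa using Matrix.BlockTriangular.mul ha hb
  inv_mem' := by
    intro A hA
    have h : ((A⁻¹ : GL (Fin n) F) : Matrix (Fin n) (Fin n) F)
        = ((A : Matrix (Fin n) (Fin n) F))⁻¹ := by
      simp [Matrix.coe_units_inv]
    simp only [Set.mem_setOf_eq] at hA ⊢
    rw [h]
    haveI : Invertible (A : Matrix (Fin n) (Fin n) F) := A.invertible
    exact blockTriangular_inv_of_blockTriangular hA


variable {F : Type*} [Field F] {n m k : ℕ}

def leviMem {α : Type*} (f : Fin n → α) (A : Matrix (Fin n) (Fin n) F) : Prop :=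
  ∀ i j, f i ≠ f j → A i j = 0

/-- the standard Levi subgroup attached to a partition function `f`
(block-diagonal invertible matrices). -/
def levi (f : Fin n → Fin m) : Subgroup (GL (Fin n) F) where
  carrier := {A | leviMem f (A : Matrix (Fin n) (Fin n) F)}
  one_mem' := by
    intro i j hij
    have : i ≠ j := fun h => hij (by rw [h])
    simp [Matrix.one_apply, this]
  mul_mem' := by
    intro A B hA hB
    intro i j hij
    show (((A : Matrix (Fin n) (Fin n) F)) * B) i j = 0
    rw [Matrix.mul_apply]
    apply Finset.sum_eq_zero
    intro x _
    by_cases h : f i = f x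
    · rw [hB x j (by rw [← h]; exact hij), mul_zero]
    · rw [hA i x h, zero_mul]
  inv_mem' := by
    intro A hA
    simp only [Set.mem_setOf_eq] at hA ⊢
    haveI : Invertible (A : Matrix (Fin n) (Fin n) F) := A.invertible
    have h1 : BlockTriangular (A : Matrix (Fin n) (Fin n) F) f := fun i j h => hA i j (ne_of_gt h)
    have h2 : BlockTriangular ((A : Matrix (Fin n) (Fin n) F))ᵀ f :=
      fun i j h => hA j i (ne_of_lt h)
    have h1' := blockTriangular_inv_of_blockTriangular h1
    haveI : Invertible ((A : Matrix (Fin n) (Fin n) F))ᵀ := Matrix.invertibleTranspose _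
    have h2' := blockTriangular_inv_of_blockTriangular h2
    have hcoe : ((A⁻¹ : GL (Fin n) F) : Matrix (Fin n) (Fin n) F)
        = ((A : Matrix (Fin n) (Fin n) F))⁻¹ := by simp [Matrix.coe_units_inv]
    rw [hcoe]
    intro i j hij
    rcases lt_or_gt_of_ne hij with h | h
    · have := h2' h
      rw [← Matrix.transpose_nonsing_inv] at this
      simpa using this
    · exact h1' h

theorem submatrix_mul_block (f : Fin n → Fin m) (a : Fin m) (e : Fin k → Fin n)
    (he : Function.Injective e) (hmem : ∀ i, f (e i) = a)
    (hsurj : ∀ j, f j = a → ∃ i, e i = j)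
    {A B : Matrix (Fin n) (Fin n) F} (hA : BlockTriangular A f) (hB : BlockTriangular B f) :
    (A * B).submatrix e e = A.submatrix e e * B.submatrix e e := by
  ext i j
  rw [Matrix.submatrix_apply, Matrix.mul_apply, Matrix.mul_apply]
  rw [show (∑ x : Fin n, A (e i) x * B x (e j))
      = ∑ x ∈ Finset.univ.image e, A (e i) x * B x (e j) from ?_]
  · rw [Finset.sum_image (fun x _ y _ h => he h)]
    simp
  · symm
    apply Finset.sum_subset (Finset.subset_univ _)
    intro x _ hx
    have hxa : f x ≠ a := by
      intro hfa
      obtain ⟨i', hi'⟩ := hsurj x hfa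
      exact hx (Finset.mem_image.mpr ⟨i', Finset.mem_univ _, hi'⟩)
    rcases lt_or_gt_of_ne hxa with h | h
    · rw [hA (show f x < f (e i) by rw [hmem]; exact h), zero_mul]
    · rw [hB (show f (e j) < f x by rw [hmem]; exact h), mul_zero]


theorem parabolic_mem' {F : Type*} [Field F] {n m : ℕ} {f : Fin n → Fin m} {A : GL (Fin n) F} :
    A ∈ parabolic f ↔ BlockTriangular (A : Matrix (Fin n) (Fin n) F) f := Iff.rfl

theorem levi_mem' {F : Type*} [Field F] {n m : ℕ} {f : Fin n → Fin m} {A : GL (Fin n) F} :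
    A ∈ levi f ↔ leviMem f (A : Matrix (Fin n) (Fin n) F) := Iff.rfl

/-- extraction of the `a`-th diagonal block, as a group homomorphism from the parabolic
subgroup to a general linear group, along an enumeration `e` of the `a`-th block. -/
def leviProj (f : Fin n → Fin m) (a : Fin m) (e : Fin k → Fin n)
    (he : Function.Injective e) (hmem : ∀ i, f (e i) = a)
    (hsurj : ∀ j, f j = a → ∃ i, e i = j) :
    (parabolic (F := F) f) →* GL (Fin k) F where
  toFun A :=
    { val := ((A : GL (Fin n) F) : Matrix (Fin n) (Fin n) F).submatrix e e
      inv := (((A : GL (Fin n) F)⁻¹ : GL (Fin n) F) : Matrix (Fin n) (Fin n) F).submatrix e e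
      val_inv := by
        rw [← submatrix_mul_block f a e he hmem hsurj (parabolic_mem'.mp A.2)
          (parabolic_mem'.mp ((parabolic f).inv_mem A.2))]
        rw [show ((A : GL (Fin n) F) : Matrix (Fin n) (Fin n) F) *
            (((A : GL (Fin n) F)⁻¹ : GL (Fin n) F) : Matrix (Fin n) (Fin n) F) = 1 by
          rw [← Units.val_mul, mul_inv_cancel, Units.val_one]]
        exact Matrix.submatrix_one e he
      inv_val := by
        rw [← submatrix_mul_block f a e he hmem hsurj
          (parabolic_mem'.mp ((parabolic f).inv_mem A.2)) (parabolic_mem'.mp A.2)]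
        rw [show (((A : GL (Fin n) F)⁻¹ : GL (Fin n) F) : Matrix (Fin n) (Fin n) F) *
            ((A : GL (Fin n) F) : Matrix (Fin n) (Fin n) F) = 1 by
          rw [← Units.val_mul, inv_mul_cancel, Units.val_one]]
        exact Matrix.submatrix_one e he }
  map_one' := by
    ext i j
    show ((1 : Matrix (Fin n) (Fin n) F).submatrix e e) i j = _
    rw [Matrix.submatrix_one e he]
    rfl
  map_mul' A B := by
    ext i j
    show ((((A * B : (parabolic f)) : GL (Fin n) F) : Matrix (Fin n) (Fin n) F).submatrix e e) i j
      = _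
    rw [show (((A * B : (parabolic f)) : GL (Fin n) F) : Matrix (Fin n) (Fin n) F)
        = ((A : GL (Fin n) F) : Matrix (Fin n) (Fin n) F) *
          ((B : GL (Fin n) F) : Matrix (Fin n) (Fin n) F) from rfl]
    rw [submatrix_mul_block f a e he hmem hsurj (parabolic_mem'.mp A.2) (parabolic_mem'.mp B.2)]
    rfl


open scoped TensorProduct

/-- exterior tensor product of representations: the product group `∀ a, G a` acts on
`⨂[ℂ] a, V a` factorwise. -/
def piTensorRep {ι : Type*} [Fintype ι] {G : ι → Type*} [∀ a, Group (G a)]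
    {V : ι → Type*} [∀ a, AddCommGroup (V a)] [∀ a, Module ℂ (V a)]
    (π : ∀ a, Representation ℂ (G a) (V a)) :
    Representation ℂ (∀ a, G a) (⨂[ℂ] a, V a) :=
  PiTensorProduct.mapMonoidHom.comp
    { toFun := fun g => fun a => π a (g a)
      map_one' := by funext a; simp
      map_mul' := fun g h => by funext a; simp }

variable {G : Type*} [Group G] {W : Type*} [AddCommGroup W] [Module ℂ W]

/-- the space of the induced representation (function model): functions `φ : G → W`
with `φ (p * g) = x p (φ g)`. -/
def IndCarrier (P : Subgroup G) (x : Representation ℂ P W) : Submodule ℂ (G → W) where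
  carrier := {φ | ∀ (p : P) (g : G), φ (↑p * g) = x p (φ g)}
  add_mem' := by
    intro φ ψ hφ hψ p g
    simp only [Pi.add_apply, hφ p g, hψ p g, map_add]
  zero_mem' := by
    intro p g
    simp
  smul_mem' := by
    intro c φ hφ p g
    simp only [Pi.smul_apply, hφ p g, _root_.map_smul]

/-- the induced representation `Ind_P^G x` in the function model, `(g • φ) y = φ (y * g)`. -/
def IndRep (P : Subgroup G) (x : Representation ℂ P W) :
    Representation ℂ G (IndCarrier P x) where
  toFun g :=
    { toFun := fun φ => ⟨fun y => (φ : G → W) (y * g), by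
        intro p y
        show (φ : G → W) (↑p * y * g) = _
        rw [mul_assoc]
        exact φ.2 p (y * g)⟩
      map_add' := fun φ ψ => by ext y; rfl
      map_smul' := fun c φ => by ext y; rfl }
  map_one' := by
    apply LinearMap.ext
    intro φ
    apply Subtype.ext
    funext y
    show (φ : G → W) (y * 1) = (φ : G → W) y
    rw [mul_one]
  map_mul' g h := by
    apply LinearMap.ext
    intro φ
    apply Subtype.ext
    funext y
    show (φ : G → W) (y * (g * h)) = (φ : G → W) (y * g * h)
    rw [mul_assoc]


theorem unip_conj {f : Fin n → Fin m} {l A : GL (Fin n) F}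
    (hl : l ∈ levi f) (hA : unipMem f (A : Matrix (Fin n) (Fin n) F)) :
    unipMem f ((l⁻¹ * A * l : GL (Fin n) F) : Matrix (Fin n) (Fin n) F) := by
  have hli : leviMem f ((l⁻¹ : GL (Fin n) F) : Matrix (Fin n) (Fin n) F) :=
    levi_mem'.mp ((levi f).inv_mem hl)
  have hlm : leviMem f ((l : GL (Fin n) F) : Matrix (Fin n) (Fin n) F) := levi_mem'.mp hl
  set li := ((l⁻¹ : GL (Fin n) F) : Matrix (Fin n) (Fin n) F) with hli_def
  set lm := ((l : GL (Fin n) F) : Matrix (Fin n) (Fin n) F) with hlm_def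
  set Am := ((A : GL (Fin n) F) : Matrix (Fin n) (Fin n) F) with hAm_def
  have hval : ((l⁻¹ * A * l : GL (Fin n) F) : Matrix (Fin n) (Fin n) F) = li * Am * lm := by
    rw [Units.val_mul, Units.val_mul]
  have hN : li * Am * lm = 1 + li * (Am - 1) * lm := by
    have h1 : li * lm = 1 := by
      rw [hli_def, hlm_def, ← Units.val_mul, inv_mul_cancel, Units.val_one]
    rw [Matrix.mul_sub, Matrix.mul_one, Matrix.sub_mul, h1]
    abel
  intro i j hij
  rw [hval, hN, Matrix.add_apply]
  have hzero : (li * (Am - 1) * lm) i j = 0 := by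
    rw [Matrix.mul_apply]
    apply Finset.sum_eq_zero
    intro t _
    by_cases ht : f t = f j
    · rw [Matrix.mul_apply]
      have : ∀ s ∈ Finset.univ, li i s * (Am - 1) s t = 0 := by
        intro s _
        by_cases hs : f i = f s
        · have hN0 : (Am - 1) s t = 0 := by
            have : ¬ f s < f t := by rw [← hs, ht]; exact hij
            rw [Matrix.sub_apply, hA s t this, sub_self]
          rw [hN0, mul_zero]
        · rw [hli i s (fun h => hs h), zero_mul]
      rw [Finset.sum_eq_zero this, zero_mul]
    · rw [hlm t j ht, mul_zero]
  rw [hzero, add_zero]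

variable {V : Type*} [AddCommGroup V] [Module ℂ V]

/-- the Jacquet restriction: the space of vectors invariant under the unipotent radical. -/
def jacquetModule (π : Representation ℂ (GL (Fin n) F) V) (f : Fin n → Fin m) :
    Submodule ℂ V where
  carrier := {v | ∀ A : GL (Fin n) F, unipMem f (A : Matrix (Fin n) (Fin n) F) → π A v = v}
  add_mem' := fun hv hw A hA => by rw [map_add, hv A hA, hw A hA]
  zero_mem' := fun A hA => by simp
  smul_mem' := fun c v hv A hA => by rw [_root_.map_smul, hv A hA]

theorem jacquet_stable (π : Representation ℂ (GL (Fin n) F) V) (f : Fin n → Fin m)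
    {l : GL (Fin n) F} (hl : l ∈ levi f) {v : V} (hv : v ∈ jacquetModule π f) :
    π l v ∈ jacquetModule π f := by
  intro A hA
  have key : A * l = l * (l⁻¹ * A * l) := by group
  have : π A (π l v) = π (A * l) v := by rw [_root_.map_mul]; rfl
  rw [this, key, _root_.map_mul]
  have : π (l⁻¹ * A * l) v = v := hv _ (unip_conj hl hA)
  show π l (π (l⁻¹ * A * l) v) = π l v
  rw [this]

/-- the Jacquet restriction of `π` as a representation of the Levi subgroup. -/
def jacquetRep (π : Representation ℂ (GL (Fin n) F) V) (f : Fin n → Fin m) :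
    Representation ℂ (levi (F := F) f) (jacquetModule π f) where
  toFun l := (π (l : GL (Fin n) F)).restrict (fun v hv => jacquet_stable π f l.2 hv)
  map_one' := by
    apply LinearMap.ext
    intro v
    apply Subtype.ext
    show π ((1 : levi (F := F) f) : GL (Fin n) F) (v : V) = (v : V)
    rw [Subgroup.coe_one, _root_.map_one]
    rfl
  map_mul' l l' := by
    apply LinearMap.ext
    intro v
    apply Subtype.ext
    show π (((l * l' : levi (F := F) f)) : GL (Fin n) F) (v : V) = _
    rw [Subgroup.coe_mul, _root_.map_mul]
    rfl



section ParabolicInduction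

variable {F : Type*} [Field F]

/-- the group homomorphism from a parabolic subgroup onto the product of the general linear
groups of its diagonal blocks. -/
def leviProjPi {N m : ℕ} (f : Fin N → Fin m) {k : Fin m → ℕ} (e : ∀ a, Fin (k a) → Fin N)
    (he : ∀ a, Function.Injective (e a)) (hmem : ∀ a i, f (e a i) = a)
    (hsurj : ∀ a j, f j = a → ∃ i, e a i = j) :
    (parabolic (F := F) f) →* (∀ a, GL (Fin (k a)) F) :=
  Pi.monoidHom (fun a => leviProj f a (e a) (he a) (hmem a) (hsurj a))

/-- parabolic induction: the representation of `GL_N(F)` induced from the inflation to the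
parabolic subgroup attached to `f` of the exterior tensor product of the `π a`. -/
def parabolicInd {N m : ℕ} (f : Fin N → Fin m) {k : Fin m → ℕ} (e : ∀ a, Fin (k a) → Fin N)
    (he : ∀ a, Function.Injective (e a)) (hmem : ∀ a i, f (e a i) = a)
    (hsurj : ∀ a j, f j = a → ∃ i, e a i = j)
    {V : Fin m → Type*} [∀ a, AddCommGroup (V a)] [∀ a, Module ℂ (V a)]
    (π : ∀ a, Representation ℂ (GL (Fin (k a)) F) (V a)) :
    Representation ℂ (GL (Fin N) F)
      (IndCarrier (parabolic f) ((piTensorRep π).comp (leviProjPi f e he hmem hsurj))) :=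
  IndRep (parabolic f) ((piTensorRep π).comp (leviProjPi f e he hmem hsurj))

end ParabolicInduction

/-- `A` is a monomial matrix (normalizes the diagonal torus) with underlying
permutation `σ`. -/
def IsMonomialWith {F : Type*} [Field F] {n : ℕ} (A : GL (Fin n) F)
    (σ : Equiv.Perm (Fin n)) : Prop :=
  ∀ i j, i ≠ σ j → (A : Matrix (Fin n) (Fin n) F) i j = 0

/-- the space of equivariant linear maps between two representations. -/
def equivariantMaps {G V W : Type*} [Group G] [AddCommGroup V] [Module ℂ V]
    [AddCommGroup W] [Module ℂ W]
    (π : Representation ℂ G V) (π' : Representation ℂ G W) : Submodule ℂ (V →ₗ[ℂ] W) where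
  carrier := {T | ∀ (g : G) (v : V), T (π g v) = π' g (T v)}
  add_mem' := by
    intro T S hT hS g v
    simp [hT g v, hS g v]
  zero_mem' := by intro g v; simp
  smul_mem' := by
    intro c T hT g v
    simp [hT g v]

/-- a representation is self-dual -/
def SelfDual {G V : Type*} [Group G] [AddCommGroup V] [Module ℂ V]
    (π : Representation ℂ G V) : Prop :=
  RepIso π π.dual

theorem unipMem.blockTriangular {f : Fin n → Fin m} {A : Matrix (Fin n) (Fin n) F}
    (hA : unipMem f A) : BlockTriangular A f := fun i j h => by
  rw [hA i j h.not_gt, Matrix.one_apply_ne (fun e => h.ne' (by rw [e]))]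

theorem unipMem.det_eq_one {f : Fin n → Fin m} {A : Matrix (Fin n) (Fin n) F}
    (hA : unipMem f A) : A.det = 1 := by
  rw [hA.blockTriangular.det]
  refine Finset.prod_eq_one fun a _ => ?_
  have hb : A.toSquareBlock f a = 1 := by
    ext i j
    have hij : ¬ f i < f j := by rw [i.2, j.2]; exact lt_irrefl a
    rw [toSquareBlock_def, Matrix.of_apply, hA i j hij, Matrix.one_apply, Matrix.one_apply]
    simp only [Subtype.ext_iff]
  rw [hb, Matrix.det_one]

theorem unipMem.exists_GL_eq {f : Fin n → Fin m} {A : Matrix (Fin n) (Fin n) F}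
    (hA : unipMem f A) : ∃ u : GL (Fin n) F, (u : Matrix (Fin n) (Fin n) F) = A :=
  (Matrix.isUnit_iff_isUnit_det A).mpr (by rw [hA.det_eq_one]; exact isUnit_one)

theorem IsMonomialWith.apply_ne_zero {C : GL (Fin n) F} {τ : Equiv.Perm (Fin n)}
    (hC : IsMonomialWith C τ) (l : Fin n) : (C : Matrix (Fin n) (Fin n) F) (τ l) l ≠ 0 := by
  intro h
  have hdet : (C : Matrix (Fin n) (Fin n) F).det ≠ 0 :=
    ((Matrix.isUnit_iff_isUnit_det _).mp C.isUnit).ne_zero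
  refine hdet (Matrix.det_eq_zero_of_column_eq_zero l fun i => ?_)
  by_cases hi : i = τ l
  · rw [hi, h]
  · exact hC i l hi

/-- If `D * C = C * N` with `C` monomial with permutation `τ`, then the support of `D` is
contained in the image under `τ` of the support of `N`. -/
theorem IsMonomialWith.apply_eq_zero_of_mul_eq {C : GL (Fin n) F} {τ : Equiv.Perm (Fin n)}
    (hC : IsMonomialWith C τ) {D N : Matrix (Fin n) (Fin n) F}
    (h : D * (C : Matrix (Fin n) (Fin n) F) = C * N) {k l : Fin n} (hkl : N k l = 0) :
    D (τ k) (τ l) = 0 := by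
  have h' := congrFun (congrFun h (τ k)) l
  rw [Matrix.mul_apply, Matrix.mul_apply, Finset.sum_eq_single (τ l), Finset.sum_eq_single k,
    hkl, mul_zero] at h'
  · exact (mul_eq_zero.mp h').resolve_right (hC.apply_ne_zero l)
  · intro b _ hb
    rw [hC _ _ (fun e => hb (τ.injective e).symm), zero_mul]
  · simp
  · intro b _ hb
    rw [hC _ _ hb, mul_zero]
  · simp

theorem leviMem.unipMem_one_add_mul {f : Fin n → Fin m} {A D : Matrix (Fin n) (Fin n) F}
    (hA : leviMem f A) (hD : ∀ i j, ¬ f i < f j → D i j = 0) : unipMem f (1 + A * D) := by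
  intro i j hij
  rw [Matrix.add_apply, Matrix.mul_apply, Finset.sum_eq_zero, add_zero]
  intro k _
  by_cases hk : f i = f k
  · rw [hD k j (by rwa [← hk]), mul_zero]
  · rw [hA i k hk, zero_mul]

/-- Let `C ∈ GL_n(𝔽_q)` normalize the diagonal torus with `C²` scalar, inducing the
involution `θ(a) = C a C⁻¹` and the index permutation `τ`. Let `x` be a representation of the
parabolic `P(T)` on which the unipotent radical `U(T)` acts trivially, and let `v` be fixed by
every `θ`-fixed element of `P(T)`. Then for every matrix `N` supported on entries `(i,j)` with
`f i = f j` and `f (τ i) < f (τ j)`, the matrix `I + N` is an invertible element of `P(T)`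
and fixes `v`. -/
theorem statement6 (q : ℕ) (hq : IsPrimePow q) (hqodd : Odd q)
    (F : Type) [Field F] [Fintype F] (hF : Fintype.card F = q)
    (n m : ℕ) (C : GL (Fin n) F) (τ : Equiv.Perm (Fin n))
    (hmono : IsMonomialWith C τ)
    (hscalar : ∃ c : F, ((C ^ 2 : GL (Fin n) F) : Matrix (Fin n) (Fin n) F) = c • (1 : Matrix (Fin n) (Fin n) F))
    (f : Fin n → Fin m)
    (W : Type) [AddCommGroup W] [Module ℂ W]
    (x : Representation ℂ (parabolic (F := F) f) W)
    (hU : ∀ u : parabolic (F := F) f,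
      unipMem f ((u : GL (Fin n) F) : Matrix (Fin n) (Fin n) F) → x u = 1)
    (v : W)
    (hv : ∀ r : parabolic (F := F) f,
      C * (r : GL (Fin n) F) * C⁻¹ = (r : GL (Fin n) F) → x r v = v)
    (N : Matrix (Fin n) (Fin n) F)
    (hN : ∀ i j, N i j ≠ 0 → f i = f j ∧ f (τ i) < f (τ j)) :
    ∃ u : GL (Fin n) F, ((u : Matrix (Fin n) (Fin n) F) = 1 + N) ∧
      ∃ hu : u ∈ parabolic (F := F) f, x ⟨u, hu⟩ v = v := by
  set Cm : Matrix (Fin n) (Fin n) F := (C : Matrix (Fin n) (Fin n) F) with hCm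
  set Ci : Matrix (Fin n) (Fin n) F := ((C⁻¹ : GL (Fin n) F) : Matrix (Fin n) (Fin n) F) with hCi
  have hCiC : Ci * Cm = 1 := by rw [hCi, hCm, ← Units.val_mul, inv_mul_cancel, Units.val_one]
  have hCCi : Cm * Ci = 1 := by rw [hCi, hCm, ← Units.val_mul, mul_inv_cancel, Units.val_one]
  obtain ⟨c, hc⟩ := hscalar
  rw [pow_two, Units.val_mul, ← hCm] at hc
  set D : Matrix (Fin n) (Fin n) F := Cm * N * Ci with hD
  have hDC : D * Cm = Cm * N := by rw [hD, Matrix.mul_assoc, hCiC, Matrix.mul_one]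
  have hCD : Cm * D = N * Cm := by
    have h1 : Cm * D = c • (N * Ci) := by
      rw [hD, ← Matrix.mul_assoc, ← Matrix.mul_assoc, hc]
      simp
    have h2 : Cm = c • Ci := by
      rw [← Matrix.mul_one Cm, ← hCCi, ← Matrix.mul_assoc, hc]
      simp
    rw [h1, h2, Matrix.mul_smul]
  have hDsupp : ∀ i j, ¬ f i < f j → D i j = 0 := by
    intro i j hij
    have h0 : N (τ.symm i) (τ.symm j) = 0 := by
      by_contra h
      exact hij (by simpa using (hN _ _ h).2)
    simpa using hmono.apply_eq_zero_of_mul_eq hDC h0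
  have haU : unipMem (fun i => f (τ i)) (1 + N) := by
    intro i j hij
    have h0 : N i j = 0 := by
      by_contra h
      exact hij (hN i j h).2
    rw [Matrix.add_apply, h0, add_zero]
  obtain ⟨a, haval⟩ := haU.exists_GL_eq
  have haL : a ∈ levi f := by
    intro i j hij
    have h0 : N i j = 0 := by
      by_contra h
      exact hij (hN i j h).1
    rw [haval, Matrix.add_apply, h0, add_zero, Matrix.one_apply_ne (fun e => hij (by rw [e]))]
  have haP : a ∈ parabolic f := fun i j h => haL i j h.ne'
  have hwU : unipMem f (1 + ((a⁻¹ : GL (Fin n) F) : Matrix (Fin n) (Fin n) F) * D) :=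
    leviMem.unipMem_one_add_mul (levi_mem'.mp ((levi f).inv_mem haL)) hDsupp
  obtain ⟨w, hw⟩ := hwU.exists_GL_eq
  rw [← hw] at hwU
  have hwP : w ∈ parabolic f := hwU.blockTriangular
  have hr : ((a * w : GL (Fin n) F) : Matrix (Fin n) (Fin n) F) = 1 + N + D := by
    rw [Units.val_mul, hw, Matrix.mul_add, Matrix.mul_one, ← Matrix.mul_assoc, ← Units.val_mul,
      mul_inv_cancel, Units.val_one, Matrix.one_mul, haval]
  have hfix : C * (a * w) * C⁻¹ = a * w := by
    rw [mul_inv_eq_iff_eq_mul]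
    apply Units.ext
    rw [Units.val_mul, Units.val_mul (a * w), hr, ← hCm]
    simp only [Matrix.mul_add, Matrix.add_mul, Matrix.one_mul, Matrix.mul_one, hDC, hCD]
    abel
  have hx := hv (⟨a, haP⟩ * ⟨w, hwP⟩) (by rw [Subgroup.coe_mul]; exact hfix)
  rw [_root_.map_mul, hU ⟨w, hwP⟩ hwU, mul_one] at hx
  exact ⟨a, haval, haP, hx⟩

end Paper
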